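/- arXiv:2201.09986 — 6 statements merged into one kernel-verified Lean document; each statement's English description precedes it below -/
import Mathlib

section
/- Let t ∈ ℕ, L ≥ 0 and E ∈ ℝ, and let M be the symmetric (t+1) × (t+1) real matrix with unit diagonal, with M_{a,b} = L for all 1 ≤ a ≠ b ≤ t, and M_{a,t+1} = M_{t+1,a} = E for 1 ≤ a ≤ t. Then Σ_{v ∈ {−1,1}^{t+1}} exp((1/2)·vᵀ M v) = exp((t(1 − L) + 1)/2) · Σ_{s ∈ {−1,1}} E_Z[(2·cosh(√L·Z + E·s))^t], where Z is a standard real Gaussian random variable. -/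
open MeasureTheory ProbabilityTheory Matrix

lemma aux_two_cosh (x : ℝ) :
    2 * Real.cosh x = ∑ a : ({-1, 1} : Finset ℝ), Real.exp ((a : ℝ) * x) := by
  rw [Finset.sum_coe_sort ({-1, 1} : Finset ℝ) (fun a => Real.exp (a * x)),
    Finset.sum_pair (by norm_num), Real.cosh_eq]
  simp
  ring

lemma aux_cosh_pow (t : ℕ) (x : ℝ) :
    (2 * Real.cosh x) ^ t =
      ∑ w : Fin t → ({-1, 1} : Finset ℝ), Real.exp ((∑ i, (w i : ℝ)) * x) := by
  rw [aux_two_cosh, Fintype.sum_pow]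
  refine Finset.sum_congr rfl fun w _ => ?_
  rw [← Real.exp_sum, Finset.sum_mul]

lemma aux_integral (t : ℕ) (L c : ℝ) (hL : 0 ≤ L) :
    ∫ z, (2 * Real.cosh (Real.sqrt L * z + c)) ^ t ∂(gaussianReal 0 1) =
      ∑ w : Fin t → ({-1, 1} : Finset ℝ),
        Real.exp (L * (∑ i, (w i : ℝ)) ^ 2 / 2 + (∑ i, (w i : ℝ)) * c) := by
  have key : ∀ S z : ℝ, Real.exp (S * (Real.sqrt L * z + c)) =
      Real.exp (S * Real.sqrt L * z) * Real.exp (S * c) := by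
    intro S z
    rw [← Real.exp_add]
    ring_nf
  simp_rw [aux_cosh_pow, key]
  rw [integral_finsetSum _ fun w _ => (integrable_exp_mul_gaussianReal _).mul_const _]
  refine Finset.sum_congr rfl fun w _ => ?_
  rw [integral_mul_const, Real.exp_add]
  congr 1
  have h := congrFun (mgf_id_gaussianReal (μ := 0) (v := 1)) ((∑ i, (w i : ℝ)) * Real.sqrt L)
  simp only [mgf, id] at h
  rw [h, mul_pow, Real.sq_sqrt hL]
  simp
  ring

lemma aux_sq (a : ({-1, 1} : Finset ℝ)) : (a : ℝ) * a = 1 := by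
  have := a.2
  simp only [Finset.mem_insert, Finset.mem_singleton] at this
  rcases this with h | h <;> rw [h] <;> norm_num

lemma aux_quad (t : ℕ) (L E : ℝ)
    (M : Matrix (Fin (t + 1)) (Fin (t + 1)) ℝ)
    (hdiag : ∀ a, M a a = 1)
    (hLL : ∀ a b : Fin (t + 1), (a : ℕ) < t → (b : ℕ) < t → a ≠ b → M a b = L)
    (hE1 : ∀ a : Fin (t + 1), (a : ℕ) < t → M a (Fin.last t) = E)
    (hE2 : ∀ a : Fin (t + 1), (a : ℕ) < t → M (Fin.last t) a = E)
    (u : Fin (t + 1) → ℝ) (hu : ∀ i, u i * u i = 1) :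
    u ⬝ᵥ M.mulVec u = t * (1 - L) + 1 + L * (∑ i : Fin t, u i.castSucc) ^ 2
      + 2 * E * (∑ i : Fin t, u i.castSucc) * u (Fin.last t) := by
  have hM : ∀ i j : Fin t, M i.castSucc j.castSucc = L + if i = j then 1 - L else 0 := by
    intro i j
    split_ifs with h
    · subst h; rw [hdiag]; ring
    · rw [hLL _ _ (by simp) (by simp) (by simpa using h)]; ring
  have h1 : ∀ i : Fin t, M i.castSucc (Fin.last t) = E := fun i => hE1 _ (by simp)
  have h2 : ∀ i : Fin t, M (Fin.last t) i.castSucc = E := fun i => hE2 _ (by simp)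
  have h3 : ∀ i : Fin t, u i.castSucc * (L * ∑ j : Fin t, u j.castSucc
      + (1 - L) * u i.castSucc + E * u (Fin.last t)) =
      (L * ∑ j : Fin t, u j.castSucc + E * u (Fin.last t)) * u i.castSucc + (1 - L) := by
    intro i
    linear_combination (1 - L) * hu i.castSucc
  simp only [dotProduct, mulVec, Fin.sum_univ_castSucc, hM, h1, h2, hdiag, add_mul,
    Finset.sum_add_distrib, ite_mul, zero_mul, Finset.sum_ite_eq, Finset.mem_univ, if_true,
    ← Finset.mul_sum]
  simp only [← add_mul, h3, Finset.sum_add_distrib, ← Finset.mul_sum, Finset.sum_const,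
    Finset.card_univ, Fintype.card_fin, nsmul_eq_mul]
  linear_combination hu (Fin.last t)

/-- Hubbard–Stratonovich linearization of the replica-symmetric quadratic
form: for the symmetric (t+1)×(t+1) matrix `M` with unit diagonal, off-diagonal value `L`
on the first `t` indices and value `E` in the last row/column,
`Σ_{v ∈ {−1,1}^{t+1}} exp((1/2) vᵀ M v)
  = exp((t(1−L)+1)/2) · Σ_{s ∈ {−1,1}} E_Z[(2 cosh(√L Z + E s))^t]`. -/
theorem sum_exp_quadratic_form_eq (t : ℕ) (L E : ℝ) (hL : 0 ≤ L)
    (M : Matrix (Fin (t + 1)) (Fin (t + 1)) ℝ)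
    (hdiag : ∀ a, M a a = 1)
    (hLL : ∀ a b : Fin (t + 1), (a : ℕ) < t → (b : ℕ) < t → a ≠ b → M a b = L)
    (hE1 : ∀ a : Fin (t + 1), (a : ℕ) < t → M a (Fin.last t) = E)
    (hE2 : ∀ a : Fin (t + 1), (a : ℕ) < t → M (Fin.last t) a = E) :
    (∑ v : Fin (t + 1) → ({-1, 1} : Finset ℝ),
        Real.exp ((1 / 2) * ((fun i => (v i : ℝ)) ⬝ᵥ M.mulVec (fun i => (v i : ℝ)))))
      = Real.exp ((t * (1 - L) + 1) / 2) *
        ∑ s ∈ ({-1, 1} : Finset ℝ),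
          ∫ z, (2 * Real.cosh (Real.sqrt L * z + E * s)) ^ t
            ∂(gaussianReal 0 1) := by
  rw [← Equiv.sum_comp (Fin.snocEquiv fun _ => ({-1, 1} : Finset ℝ)), Fintype.sum_prod_type,
    ← Finset.sum_coe_sort ({-1, 1} : Finset ℝ), Finset.mul_sum]
  refine Finset.sum_congr rfl fun s _ => ?_
  rw [aux_integral t L _ hL, Finset.mul_sum]
  refine Finset.sum_congr rfl fun w _ => ?_
  rw [aux_quad t L E M hdiag hLL hE1 hE2 _ (fun i => aux_sq _), ← Real.exp_add]
  simp only [Fin.snocEquiv, Equiv.coe_fn_mk, Fin.snoc_castSucc, Fin.snoc_last]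
  congr 1
  ring
end

section
/- Fix an integer λ ≥ 1 and R > 0, σ > 0. For every m ∈ (0,1] there exists a constant C ∈ [0,1] such that L_m(σ) = (1/2)·[log(1 + ξ_m) + (C + m)·R/ρ_m²] − R·log cosh(1/ρ_m²). (This is Corollary 2 of the paper, applied at m = m*.) -/
open MeasureTheory ProbabilityTheory

namespace MFE

noncomputable def f (x : ℝ) : ℝ := Real.log (Real.cosh x)

lemma hf (x : ℝ) : HasDerivAt f (Real.sinh x / Real.cosh x) x :=
  (Real.hasDerivAt_cosh x).log (Real.cosh_pos x).ne'

lemma hf2 (x : ℝ) : HasDerivAt (fun x => Real.sinh x / Real.cosh x) (1 / Real.cosh x ^ 2) x := by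
  have h := (Real.hasDerivAt_sinh x).div (Real.hasDerivAt_cosh x) (Real.cosh_pos x).ne'
  have e : (Real.cosh x * Real.cosh x - Real.sinh x * Real.sinh x) / Real.cosh x ^ 2
      = 1 / Real.cosh x ^ 2 := by
    congr 1
    linarith [Real.cosh_sq_sub_sinh_sq x]
  rw [e] at h
  exact h

lemma convex_of (g g1 g2 : ℝ → ℝ) (h1 : ∀ x, HasDerivAt g (g1 x) x)
    (h2 : ∀ x, HasDerivAt g1 (g2 x) x) (h : ∀ x, 0 ≤ g2 x) : ConvexOn ℝ Set.univ g := by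
  have e1 : deriv g = g1 := funext fun x => (h1 x).deriv
  apply convexOn_univ_of_deriv2_nonneg
  · exact fun x => (h1 x).differentiableAt
  · rw [e1]; exact fun x => (h2 x).differentiableAt
  · intro x
    simp only [Function.iterate_succ, Function.iterate_zero, Function.comp, id]
    rw [e1, (h2 x).deriv]; exact h x

lemma convex_f : ConvexOn ℝ Set.univ f :=
  convex_of f _ _ hf hf2 (fun x => by positivity)

lemma convex_g : ConvexOn ℝ Set.univ (fun x => x ^ 2 / 2 - f x) := by
  refine convex_of _ (fun x => x - Real.sinh x / Real.cosh x) (fun x => 1 - 1 / Real.cosh x ^ 2)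
    (fun x => ?_) (fun x => (hasDerivAt_id x).sub (hf2 x)) (fun x => ?_)
  · have h := (((hasDerivAt_id x).pow 2).div_const 2).sub (hf x)
    refine HasDerivAt.congr_deriv h ?_
    simp
  · have := Real.one_le_cosh x
    rw [sub_nonneg, div_le_one (by positivity)]
    nlinarith

lemma f_cont : Continuous f := continuous_iff_continuousAt.2 fun x => (hf x).continuousAt

lemma f_nonneg (x : ℝ) : 0 ≤ f x := Real.log_nonneg (Real.one_le_cosh x)

lemma f_le (x : ℝ) : f x ≤ |x| := by
  unfold f
  rw [Real.log_le_iff_le_exp (Real.cosh_pos x), Real.cosh_eq]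
  have h1 := Real.exp_le_exp.2 (le_abs_self x)
  have h2 := Real.exp_le_exp.2 (neg_le_abs x)
  linarith

lemma key (a s : ℝ) (hs : s ^ 2 = a) :
    f a ≤ ∫ z, f (a + s * z) ∂(gaussianReal 0 1) ∧
    ∫ z, f (a + s * z) ∂(gaussianReal 0 1) ≤ f a + a / 2 := by
  have i1 : Integrable (fun z : ℝ => z) (gaussianReal 0 1) :=
    (memLp_id_gaussianReal 1).integrable le_rfl
  have i2 : Integrable (fun z : ℝ => z ^ 2) (gaussianReal 0 1) :=
    (memLp_id_gaussianReal 2).integrable_sq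
  have e1 : ∫ z, z ∂(gaussianReal 0 1) = 0 := integral_id_gaussianReal
  have e2 : ∫ z, z ^ 2 ∂(gaussianReal 0 1) = 1 := by
    have h := variance_id_gaussianReal (μ := 0) (v := 1)
    rw [variance_eq_sub (memLp_id_gaussianReal 2)] at h
    simpa [e1] using h
  have iX : Integrable (fun z : ℝ => a + s * z) (gaussianReal 0 1) :=
    (integrable_const a).add (i1.const_mul s)
  have eX : ∫ z, (a + s * z) ∂(gaussianReal 0 1) = a := by
    rw [integral_add (integrable_const a) (i1.const_mul s), integral_const_mul, e1]; simp
  have iF : Integrable (fun z : ℝ => f (a + s * z)) (gaussianReal 0 1) := by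
    refine iX.mono (f_cont.comp (by fun_prop)).aestronglyMeasurable (ae_of_all _ fun z => ?_)
    rw [Real.norm_eq_abs, abs_of_nonneg (f_nonneg _)]
    exact f_le _
  have hsq : (fun z : ℝ => (a + s * z) ^ 2 / 2) =
      fun z => a ^ 2 / 2 + ((a * s) * z + (s ^ 2 / 2) * z ^ 2) := by funext z; ring
  have iQ' : Integrable (fun z : ℝ => (a * s) * z + (s ^ 2 / 2) * z ^ 2) (gaussianReal 0 1) :=
    (i1.const_mul _).add (i2.const_mul _)
  have iQ : Integrable (fun z : ℝ => (a + s * z) ^ 2 / 2) (gaussianReal 0 1) := by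
    rw [hsq]; exact (integrable_const _).add iQ'
  have eQ : ∫ z, (a + s * z) ^ 2 / 2 ∂(gaussianReal 0 1) = a ^ 2 / 2 + a / 2 := by
    rw [hsq, integral_add (integrable_const _) iQ', integral_add (i1.const_mul _) (i2.const_mul _),
      integral_const_mul, integral_const_mul, e1, e2, hs]
    simp
  constructor
  · have := convex_f.map_integral_le f_cont.continuousOn isClosed_univ
      (ae_of_all _ fun _ => Set.mem_univ _) iX iF
    rwa [eX] at this
  · have hc : Continuous (fun x => x ^ 2 / 2 - f x) := by
      have := f_cont
      fun_prop
    have := convex_g.map_integral_le hc.continuousOn isClosed_univ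
      (ae_of_all _ fun _ => Set.mem_univ _) iX (iQ.sub iF)
    rw [eX, integral_sub iQ iF, eQ] at this
    linarith

end MFE



/-- Corollary 2 of the paper: for every `m ∈ (0,1]` there exists a
constant `C ∈ [0,1]` such that the modified free energy satisfies
`L_m(σ) = (1/2)[log(1+ξ_m) + (C+m)R/ρ_m²] − R·log cosh(1/ρ_m²)`. -/
theorem modified_free_energy_bound (lam : ℕ) (hlam : 1 ≤ lam)
    (R σ m : ℝ) (hR : 0 < R) (hσ : 0 < σ) (hm0 : 0 < m) (hm1 : m ≤ 1)
    (ξ ρsq Lm : ℝ)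
    (hξ : ξ = (1 - m ^ lam) / σ ^ 2)
    (hρ : ρsq = R * σ ^ 2 * (1 + ξ) / (lam * m ^ (lam - 1)))
    (hLm : Lm = (1 / 2) * Real.log (1 + ξ) + (1 + m) * R / (2 * ρsq)
        - R * ∫ z, Real.log (Real.cosh ((1 + Real.sqrt ρsq * z) / ρsq))
            ∂(gaussianReal 0 1)) :
    ∃ C : ℝ, 0 ≤ C ∧ C ≤ 1 ∧
      Lm = (1 / 2) * (Real.log (1 + ξ) + (C + m) * R / ρsq)
        - R * Real.log (Real.cosh (1 / ρsq)) := by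
  have hpow : m ^ lam ≤ 1 := pow_le_one₀ hm0.le hm1
  have hξ0 : 0 ≤ ξ := by rw [hξ]; exact div_nonneg (by linarith) (by positivity)
  have hlam' : (0 : ℝ) < lam := by exact_mod_cast hlam
  have hρ0 : 0 < ρsq := by rw [hρ]; positivity
  clear hρ hξ
  obtain ⟨h1, h2⟩ := MFE.key (1 / ρsq) (Real.sqrt ρsq / ρsq) (by
    rw [div_pow, Real.sq_sqrt hρ0.le]; field_simp)
  have e : (fun z => Real.log (Real.cosh ((1 + Real.sqrt ρsq * z) / ρsq))) =
      fun z => MFE.f (1 / ρsq + Real.sqrt ρsq / ρsq * z) := by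
    funext z
    unfold MFE.f
    congr 2
    ring
  rw [e] at hLm
  change ∃ C : ℝ, 0 ≤ C ∧ C ≤ 1 ∧ Lm = (1 / 2) * (Real.log (1 + ξ) + (C + m) * R / ρsq)
        - R * MFE.f (1 / ρsq)
  generalize (∫ z, MFE.f (1 / ρsq + Real.sqrt ρsq / ρsq * z) ∂(gaussianReal 0 1)) = I at *
  generalize MFE.f (1 / ρsq) = F at *
  refine ⟨1 - 2 * ρsq * (I - F), ?_, ?_, ?_⟩
  · have h3 : ρsq * (I - F) ≤ ρsq * (1 / ρsq / 2) :=
      mul_le_mul_of_nonneg_left (by linarith) hρ0.le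
    have h4 : ρsq * (1 / ρsq / 2) = 1 / 2 := by field_simp
    linarith
  · have : 0 ≤ ρsq * (I - F) := mul_nonneg hρ0.le (by linarith)
    linarith
  · rw [hLm]
    field_simp
    ring
end

section
/- (Lemma 1: inference guarantee for the linear model.) Let λ = 1 and fix any R > 0 and σ > 0. Then there exists m ∈ (0,1] such that L_m(σ) < L_0(σ); consequently m = 0 is not a global minimizer of the modified free energy m ↦ L_m(σ) over [0,1], i.e., the overlap of the linear model is always non-zero. -/
open MeasureTheory ProbabilityTheory

/-- The replica-symmetric modified free energy `L_m(σ)` of the linear model (λ = 1):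
here `ξ_m = (1−m)/σ²` and `ρ_m² = R(σ²+1−m)`, so that
`L_m(σ) = (1/2)log(1+ξ_m) + (1+m)R/(2ρ_m²) − R·E[log cosh((1+ρ_m Z)/ρ_m²)]`;
this formula is also the continuous extension at `m = 0`. -/
noncomputable def modFreeEnergyLin (R σ m : ℝ) : ℝ :=
  (1 / 2) * Real.log (1 + (1 - m) / σ ^ 2)
    + (1 + m) * R / (2 * (R * (σ ^ 2 + 1 - m)))
    - R * ∫ z, Real.log (Real.cosh ((1 + Real.sqrt (R * (σ ^ 2 + 1 - m)) * z)
        / (R * (σ ^ 2 + 1 - m)))) ∂(gaussianReal 0 1)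

namespace LMIG

lemma int_id : Integrable (fun z : ℝ => z) (gaussianReal 0 1) :=
  (memLp_id_gaussianReal' (μ := 0) (v := 1) 1 (by simp)).integrable le_rfl

lemma tanh_bd (x : ℝ) : |Real.tanh x| ≤ 1 := (Real.abs_tanh_lt_one x).le

lemma cont_tanh : Continuous Real.tanh := by
  have : Real.tanh = fun x => Real.sinh x / Real.cosh x := by
    funext x; exact Real.tanh_eq_sinh_div_cosh x
  rw [this]
  exact Real.continuous_sinh.div Real.continuous_cosh (fun x => (Real.cosh_pos x).ne')

/-- Symmetry of the Gaussian `N(s²,s²)`. -/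
lemma symm (s : ℝ) (h : ℝ → ℝ) (hodd : ∀ x, h (-x) = - h x) :
    ∫ z, h (s ^ 2 + s * z) * Real.exp (-(s ^ 2 + s * z)) ∂(gaussianReal 0 1) = 0 := by
  rw [integral_gaussianReal_eq_integral_smul (by simp)]
  have key := integral_sub_left_eq_self (μ := (volume : Measure ℝ))
    (fun z => gaussianPDFReal 0 1 z • (h (s ^ 2 + s * z) * Real.exp (-(s ^ 2 + s * z)))) (-2 * s)
  have h2 : (fun z => gaussianPDFReal 0 1 (-2 * s - z) •
      (h (s ^ 2 + s * (-2 * s - z)) * Real.exp (-(s ^ 2 + s * (-2 * s - z))))) =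
      fun z => - (gaussianPDFReal 0 1 z • (h (s ^ 2 + s * z) * Real.exp (-(s ^ 2 + s * z)))) := by
    funext z
    have e1 : s ^ 2 + s * (-2 * s - z) = -(s ^ 2 + s * z) := by ring
    rw [e1, hodd]
    simp only [gaussianPDFReal, smul_eq_mul, NNReal.coe_one]
    have e2 : Real.exp (-(-2 * s - z - 0) ^ 2 / (2 * 1)) * Real.exp (- -(s ^ 2 + s * z))
        = Real.exp (-(z - 0) ^ 2 / (2 * 1)) * Real.exp (-(s ^ 2 + s * z)) := by
      rw [← Real.exp_add, ← Real.exp_add]; congr 1; ring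
    linear_combination (-(√(2 * Real.pi * 1))⁻¹ * h (s ^ 2 + s * z)) * e2
  rw [h2, integral_neg] at key
  linarith

lemma one_sub_tanh (y : ℝ) : 1 - Real.tanh y = Real.exp (-y) / Real.cosh y := by
  rw [Real.tanh_eq_sinh_div_cosh, ← Real.cosh_sub_sinh]
  field_simp [(Real.cosh_pos y).ne']

lemma int_Y (s : ℝ) : Integrable (fun z : ℝ => s ^ 2 + s * z) (gaussianReal 0 1) :=
  (integrable_const _).add (int_id.const_mul s)

lemma meas_tanh (s : ℝ) :
    AEStronglyMeasurable (fun z : ℝ => Real.tanh (s ^ 2 + s * z)) (gaussianReal 0 1) :=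
  (cont_tanh.comp (by fun_prop)).aestronglyMeasurable

lemma int_tanh (s : ℝ) :
    Integrable (fun z : ℝ => Real.tanh (s ^ 2 + s * z)) (gaussianReal 0 1) :=
  Integrable.of_bound (meas_tanh s) 1 (by
    filter_upwards with z; exact tanh_bd _)

lemma int_mul_tanh (s : ℝ) (f : ℝ → ℝ) (hf : Integrable f (gaussianReal 0 1)) :
    Integrable (fun z : ℝ => f z * Real.tanh (s ^ 2 + s * z)) (gaussianReal 0 1) :=
  hf.mul_bdd (c := 1) (meas_tanh s) (by filter_upwards with z; exact tanh_bd _)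

lemma E_Y_tanh (s : ℝ) :
    ∫ z, (s ^ 2 + s * z) * Real.tanh (s ^ 2 + s * z) ∂(gaussianReal 0 1) = s ^ 2 := by
  have h := symm s (fun y => y / Real.cosh y) (fun x => by simp [neg_div])
  have e : (fun z => (s ^ 2 + s * z) / Real.cosh (s ^ 2 + s * z) * Real.exp (-(s ^ 2 + s * z)))
      = fun z => (s ^ 2 + s * z) - (s ^ 2 + s * z) * Real.tanh (s ^ 2 + s * z) := by
    funext z
    have := one_sub_tanh (s ^ 2 + s * z)
    linear_combination (-(s ^ 2 + s * z)) * this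
  rw [e, integral_sub (int_Y s) (int_mul_tanh s _ (int_Y s)),
    integral_add (integrable_const _) (int_id.const_mul s), integral_const_mul,
    integral_id_gaussianReal] at h
  simp at h
  linarith

lemma E_tanh_pos (s : ℝ) (hs : 0 < s) :
    0 < ∫ z, Real.tanh (s ^ 2 + s * z) ∂(gaussianReal 0 1) := by
  have h := symm s (fun y => Real.tanh y / Real.cosh y) (fun x => by simp [neg_div])
  have e : (fun z => Real.tanh (s ^ 2 + s * z) / Real.cosh (s ^ 2 + s * z)
        * Real.exp (-(s ^ 2 + s * z)))
      = fun z => Real.tanh (s ^ 2 + s * z)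
        - Real.tanh (s ^ 2 + s * z) * Real.tanh (s ^ 2 + s * z) := by
    funext z
    have := one_sub_tanh (s ^ 2 + s * z)
    linear_combination (-Real.tanh (s ^ 2 + s * z)) * this
  have hi := int_mul_tanh s _ (int_tanh s)
  rw [e, integral_sub (int_tanh s) hi] at h
  have hp : 0 < ∫ z, Real.tanh (s ^ 2 + s * z) * Real.tanh (s ^ 2 + s * z)
      ∂(gaussianReal 0 1) := by
    rw [integral_pos_iff_support_of_nonneg (fun z => mul_self_nonneg _) hi]
    have hsub : ({-s} : Set ℝ)ᶜ ⊆ Function.support (fun z : ℝ =>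
        Real.tanh (s ^ 2 + s * z) * Real.tanh (s ^ 2 + s * z)) := by
      intro z hz
      simp only [Function.mem_support, ne_eq, mul_self_eq_zero]
      intro h0
      apply hz
      rw [Real.tanh_eq_sinh_div_cosh, div_eq_zero_iff] at h0
      rcases h0 with h0 | h0
      · rw [Real.sinh_eq_zero] at h0
        have : s * (s + z) = 0 := by linarith
        rcases mul_eq_zero.1 this with h1 | h1
        · exact absurd h1 hs.ne'
        · simp only [Set.mem_singleton_iff]; linarith
      · exact absurd h0 (Real.cosh_pos _).ne'
    refine lt_of_lt_of_le ?_ (measure_mono hsub)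
    have := nullSingletonClass_gaussianReal (μ := 0) (v := 1) (by simp)
    rw [prob_compl_eq_one_sub (measurableSet_singleton _), measure_singleton]
    simp
  linarith

lemma abs_log_cosh (x : ℝ) : |Real.log (Real.cosh x)| ≤ |x| := by
  rw [abs_of_nonneg (Real.log_nonneg (Real.one_le_cosh x)), Real.log_le_iff_le_exp (Real.cosh_pos x),
    ← Real.cosh_abs, Real.cosh_eq]
  have : Real.exp (-|x|) ≤ Real.exp |x| := Real.exp_le_exp.2 (by linarith [abs_nonneg x])
  linarith

noncomputable def G (s : ℝ) : ℝ :=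
  ∫ z, Real.log (Real.cosh (s ^ 2 + s * z)) ∂(gaussianReal 0 1)

lemma hasDeriv_G (s : ℝ) :
    HasDerivAt G (∫ z, (2 * s + z) * Real.tanh (s ^ 2 + s * z) ∂(gaussianReal 0 1)) s := by
  have hc : ∀ x : ℝ, Continuous (fun z : ℝ => Real.log (Real.cosh (x ^ 2 + x * z))) := fun x =>
    Continuous.log (Real.continuous_cosh.comp (by fun_prop)) (fun z => (Real.cosh_pos _).ne')
  refine (hasDerivAt_integral_of_dominated_loc_of_deriv_le (μ := gaussianReal 0 1)
    (F := fun s z => Real.log (Real.cosh (s ^ 2 + s * z)))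
    (F' := fun s z => (2 * s + z) * Real.tanh (s ^ 2 + s * z))
    (bound := fun z => 2 * (|s| + 1) + |z|) (Metric.ball_mem_nhds s one_pos) ?_ ?_ ?_ ?_ ?_ ?_).2
  · filter_upwards with x using (hc x).aestronglyMeasurable
  · refine (int_Y s).mono (hc s).aestronglyMeasurable ?_
    filter_upwards with z using abs_log_cosh _
  · exact ((by fun_prop : Continuous (fun z : ℝ => 2 * s + z)).mul
      (cont_tanh.comp (by fun_prop))).aestronglyMeasurable
  · filter_upwards with z x hx
    rw [norm_mul, Real.norm_eq_abs, Real.norm_eq_abs]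
    have h1 : |x| ≤ |s| + 1 := by
      have : |x - s| < 1 := by simpa [Real.dist_eq] using hx
      have := abs_sub_abs_le_abs_sub x s
      linarith
    have h2 : |2 * x + z| ≤ 2 * (|s| + 1) + |z| := by
      have := abs_add_le (2 * x) z
      rw [abs_mul, abs_two] at this
      linarith
    nlinarith [tanh_bd (x ^ 2 + x * z), abs_nonneg (2 * x + z)]
  · exact (integrable_const _).add int_id.abs
  · filter_upwards with z x hx
    have h1 : HasDerivAt (fun x : ℝ => x ^ 2 + x * z) (2 * x + z) x := by
      have := (hasDerivAt_pow 2 x).add ((hasDerivAt_id x).mul_const z)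
      have e : 2 * x + z = ((2:ℕ):ℝ) * x ^ (2 - 1) + 1 * z := by simp
      rw [e]
      exact this
    have := (h1.cosh).log (Real.cosh_pos _).ne'
    have e : (2 * x + z) * Real.tanh (x ^ 2 + x * z) =
        Real.sinh (x ^ 2 + x * z) * (2 * x + z) / Real.cosh (x ^ 2 + x * z) := by
      rw [Real.tanh_eq_sinh_div_cosh]; ring
    simp only [e]
    exact this

lemma deriv_G_gt (s : ℝ) (hs : 0 < s) :
    s < ∫ z, (2 * s + z) * Real.tanh (s ^ 2 + s * z) ∂(gaussianReal 0 1) := by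
  have e : (fun z => (2 * s + z) * Real.tanh (s ^ 2 + s * z)) =
      fun z => s * Real.tanh (s ^ 2 + s * z)
        + s⁻¹ * ((s ^ 2 + s * z) * Real.tanh (s ^ 2 + s * z)) := by
    funext z; field_simp; ring
  rw [e, integral_add ((int_tanh s).const_mul s) ((int_mul_tanh s _ (int_Y s)).const_mul _),
    integral_const_mul, integral_const_mul, E_Y_tanh]
  have := mul_pos hs (E_tanh_pos s hs)
  have e2 : s⁻¹ * s ^ 2 = s := by field_simp
  linarith

lemma L_eq (R σ m : ℝ) (ha : 0 < R * (σ ^ 2 + 1 - m)) :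
    modFreeEnergyLin R σ m = (1 / 2) * Real.log (1 + (1 - m) / σ ^ 2)
    + (1 + m) * R / (2 * (R * (σ ^ 2 + 1 - m))) - R * G ((√(R * (σ ^ 2 + 1 - m)))⁻¹) := by
  unfold modFreeEnergyLin G
  congr 2
  refine integral_congr_ae ?_
  filter_upwards with z
  congr 2
  have h1 := Real.sq_sqrt ha.le
  have h2 := Real.sqrt_pos.2 ha
  set a := R * (σ ^ 2 + 1 - m)
  rw [← h1, Real.sqrt_sq h2.le]
  field_simp

lemma deriv_L (R σ : ℝ) (hR : 0 < R) (hσ : 0 < σ) :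
    ∃ d < 0, HasDerivAt (modFreeEnergyLin R σ) d 0 := by
  have ha : 0 < R * (σ ^ 2 + 1 - 0) := by rw [sub_zero]; positivity
  have hr := Real.sqrt_pos.2 ha
  have hr2 := Real.sq_sqrt ha.le
  have hA : HasDerivAt (fun m : ℝ => R * (σ ^ 2 + 1 - m)) (-R) 0 := by
    simpa using ((hasDerivAt_id (0:ℝ)).const_sub (σ ^ 2 + 1)).const_mul R
  have hS := (hA.sqrt ha.ne').inv hr.ne'
  have hG := (hasDeriv_G _).comp (0:ℝ) hS
  have hD := deriv_G_gt _ (inv_pos.2 hr)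
  have hlog : HasDerivAt (fun m : ℝ => Real.log (1 + (1 - m) / σ ^ 2))
      ((-1 / σ ^ 2) / (1 + (1 - 0) / σ ^ 2)) 0 := by
    refine HasDerivAt.log ?_ (by positivity)
    simpa using (((hasDerivAt_id (0:ℝ)).const_sub 1).div_const (σ ^ 2)).const_add 1
  have hN : HasDerivAt (fun m : ℝ => (1 + m) * R) R 0 := by
    simpa using (((hasDerivAt_id (0:ℝ)).const_add 1).mul_const R)
  have hQ := hN.div (hA.const_mul 2) (by positivity)
  have hL := ((hlog.const_mul (1/2)).add hQ).sub (hG.const_mul R)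
  refine ⟨_, ?_, hL.congr_of_eventuallyEq ?_⟩
  · simp only [Pi.inv_apply] at *
    set D := ∫ z, (2 * (√(R * (σ ^ 2 + 1 - 0)))⁻¹ + z) * Real.tanh
      ((√(R * (σ ^ 2 + 1 - 0)))⁻¹ ^ 2 + (√(R * (σ ^ 2 + 1 - 0)))⁻¹ * z) ∂(gaussianReal 0 1)
    set r := √(R * (σ ^ 2 + 1 - 0))
    have e1 : (1 / 2) * ((-1 / σ ^ 2) / (1 + (1 - 0) / σ ^ 2)) = - (R / (2 * r ^ 2)) := by
      have hp : (0:ℝ) < σ ^ 2 + 1 := by positivity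
      rw [hr2, sub_zero, sub_zero]
      have hq : 1 + 1 / σ ^ 2 = (σ ^ 2 + 1) / σ ^ 2 := by field_simp
      rw [hq]
      field_simp
    rw [e1, ← hr2]
    have e2 : -(R / (2 * r ^ 2)) + (R * (2 * r ^ 2) - (1 + 0) * R * (2 * -R)) / (2 * r ^ 2) ^ 2
        - R * (D * (-(-R / (2 * r)) / r ^ 2)) = R ^ 2 / (2 * r ^ 3) * (r⁻¹ - D) := by
      field_simp; ring
    rw [e2]
    exact mul_neg_of_pos_of_neg (by positivity) (by linarith)
  · have : ∀ᶠ m in nhds (0:ℝ), 0 < R * (σ ^ 2 + 1 - m) :=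
      hA.continuousAt.eventually (lt_mem_nhds ha)
    filter_upwards [this] with m hm
    rw [L_eq R σ m hm]
    rfl

end LMIG

/-- Lemma 1: inference guarantee for the linear model: for every
`R > 0`, `σ > 0` there is `m ∈ (0,1]` with `L_m(σ) < L_0(σ)`; consequently `m = 0` is
not a global minimizer of `m ↦ L_m(σ)` on `[0,1]`, i.e. the overlap of the linear model
is always non-zero. -/
theorem linear_model_inference_guarantee (R σ : ℝ) (hR : 0 < R) (hσ : 0 < σ) :
    (∃ m : ℝ, 0 < m ∧ m ≤ 1 ∧ modFreeEnergyLin R σ m < modFreeEnergyLin R σ 0) ∧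
    ¬ (∀ m : ℝ, 0 ≤ m → m ≤ 1 → modFreeEnergyLin R σ 0 ≤ modFreeEnergyLin R σ m) := by
  have main : ∃ m : ℝ, 0 < m ∧ m ≤ 1 ∧ modFreeEnergyLin R σ m < modFreeEnergyLin R σ 0 := by
    obtain ⟨d, hd, hL⟩ := LMIG.deriv_L R σ hR hσ
    have h1 := (hasDerivAt_iff_tendsto_slope.1 hL).eventually (gt_mem_nhds hd)
    have h2 : ∀ᶠ m in nhdsWithin (0:ℝ) (Set.Ioi 0),
        slope (modFreeEnergyLin R σ) 0 m < 0 :=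
      h1.filter_mono (nhdsWithin_mono _ (fun x hx => ne_of_gt hx))
    obtain ⟨m, hm, hm0, hm1⟩ := (h2.and (Ioc_mem_nhdsGT (one_pos : (0:ℝ) < 1))).exists
    refine ⟨m, hm0, hm1, ?_⟩
    rw [slope_def_field, sub_zero, div_lt_iff₀ hm0] at hm
    linarith
  refine ⟨main, fun h => ?_⟩
  obtain ⟨m, h0, h1, h2⟩ := main
  exact absurd (h m h0.le h1) (not_le.2 h2)
end

section
/- Let λ = 1 and fix any R > 0 and σ > 0. The function m ↦ L_m(σ) on [0,1] is differentiable from the right at m = 0 and its right derivative at m = 0 is strictly negative. -/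
open MeasureTheory ProbabilityTheory

open Real in
lemma aux_odd (s : ℝ) (g : ℝ → ℝ) (hg : ∀ x, g (-x) = - g x) :
    ∫ z, g (s^2 + s*z) * Real.exp (-(s^2 + s*z)) ∂(gaussianReal 0 1) = 0 := by
  rw [integral_gaussianReal_eq_integral_smul one_ne_zero]
  set f : ℝ → ℝ := fun z => gaussianPDFReal 0 1 z • (g (s^2 + s*z) * Real.exp (-(s^2 + s*z))) with hf
  have h1 : ∫ z, f (-2*s - z) = ∫ z, f z := integral_sub_left_eq_self f volume (-2*s)
  have h2 : ∀ z, f (-2*s - z) = - f z := by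
    intro z
    simp only [hf, gaussianPDFReal_def, smul_eq_mul]
    have e1 : s^2 + s*(-2*s - z) = -(s^2 + s*z) := by ring
    rw [e1, hg]
    have e2 : rexp (-(-2*s - z - 0) ^ 2 / (2 * ((1:NNReal):ℝ))) * rexp (-(-(s^2+s*z)))
        = rexp (-(z - 0) ^ 2 / (2 * ((1:NNReal):ℝ))) * rexp (-(s^2+s*z)) := by
      rw [← Real.exp_add, ← Real.exp_add]
      congr 1
      push_cast
      ring
    linear_combination (-(√(2 * π * ((1:NNReal):ℝ)))⁻¹ * g (s^2+s*z)) * e2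
  simp_rw [h2, integral_neg] at h1
  linarith

lemma aux_tanh_cont : Continuous Real.tanh := by
  have : Real.tanh = fun x => Real.sinh x / Real.cosh x := by
    ext x; exact Real.tanh_eq_sinh_div_cosh x
  rw [this]
  exact Real.continuous_sinh.div Real.continuous_cosh (fun x => (Real.cosh_pos x).ne')

lemma aux_tanh (x : ℝ) : 1 - Real.tanh x = Real.exp (-x) / Real.cosh x := by
  have := (Real.cosh_pos x).ne'
  rw [Real.tanh_eq_sinh_div_cosh, ← Real.cosh_sub_sinh]
  field_simp

lemma aux_intz : Integrable (fun z : ℝ => z) (gaussianReal 0 1) := by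
  have := (memLp_id_gaussianReal (μ := 0) (v := 1) 1).integrable (by simp)
  exact this

lemma aux_int_mul (f : ℝ → ℝ) (hf : Integrable f (gaussianReal 0 1)) (s : ℝ) :
    Integrable (fun z => f z * Real.tanh (s^2 + s*z)) (gaussianReal 0 1) := by
  refine hf.mul_bdd (c := 1) ?_ ?_
  · exact (aux_tanh_cont.comp (by fun_prop)).aestronglyMeasurable
  · exact Filter.Eventually.of_forall fun z => (Real.abs_tanh_lt_one _).le

lemma aux_intX (s : ℝ) : Integrable (fun z : ℝ => s^2 + s*z) (gaussianReal 0 1) :=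
  (integrable_const _).add (aux_intz.const_mul s)

/-- `E[X tanh X] = E[X]`. -/
lemma aux_X (s : ℝ) :
    ∫ z, (s^2 + s*z) * Real.tanh (s^2 + s*z) ∂(gaussianReal 0 1) = s^2 := by
  have h := aux_odd s (fun x => x / Real.cosh x) (fun x => by simp [neg_div])
  have e : ∀ z, (s^2 + s*z) / Real.cosh (s^2+s*z) * Real.exp (-(s^2 + s*z))
      = (s^2+s*z) - (s^2+s*z) * Real.tanh (s^2+s*z) := fun z => by
    have := aux_tanh (s^2+s*z)
    linear_combination -(s^2+s*z) * this
  simp_rw [e] at h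
  rw [integral_sub (aux_intX s) (aux_int_mul _ (aux_intX s) s),
    integral_add (integrable_const _) (aux_intz.const_mul s), integral_const_mul,
    integral_id_gaussianReal] at h
  simp at h
  linarith

lemma aux_T (s : ℝ) (hs : 0 < s) :
    0 < ∫ z, Real.tanh (s^2 + s*z) ∂(gaussianReal 0 1) := by
  have h := aux_odd s (fun x => Real.tanh x / Real.cosh x) (fun x => by simp [neg_div])
  have e : ∀ z, Real.tanh (s^2 + s*z) / Real.cosh (s^2+s*z) * Real.exp (-(s^2 + s*z))
      = Real.tanh (s^2+s*z) - Real.tanh (s^2+s*z) * Real.tanh (s^2+s*z) := fun z => by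
    have := aux_tanh (s^2+s*z)
    linear_combination -Real.tanh (s^2+s*z) * this
  simp_rw [e] at h
  have i1 : Integrable (fun z => Real.tanh (s^2 + s*z)) (gaussianReal 0 1) := by
    simpa using aux_int_mul (fun _ => 1) (integrable_const _) s
  have i2 := aux_int_mul _ i1 s
  rw [integral_sub i1 i2] at h
  have hT : ∫ z, Real.tanh (s^2 + s*z) ∂(gaussianReal 0 1)
    = ∫ z, Real.tanh (s^2+s*z) * Real.tanh (s^2+s*z) ∂(gaussianReal 0 1) := by linarith
  rw [hT]
  have hnn : 0 ≤ fun z => Real.tanh (s^2+s*z) * Real.tanh (s^2+s*z) :=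
    fun z => mul_self_nonneg _
  refine lt_of_le_of_ne (integral_nonneg hnn) fun h0 => ?_
  have hae := (integral_eq_zero_iff_of_nonneg hnn i2).1 h0.symm
  have hX := aux_X s
  have : ∫ z, (s^2 + s*z) * Real.tanh (s^2 + s*z) ∂(gaussianReal 0 1) = 0 := by
    rw [integral_eq_zero_of_ae]
    filter_upwards [hae] with z hz
    have : Real.tanh (s^2+s*z) = 0 := mul_self_eq_zero.1 hz
    simp [this]
  rw [this] at hX
  have : 0 < s^2 := by positivity
  linarith

lemma aux_logcosh (x : ℝ) : |Real.log (Real.cosh x)| ≤ |x| := by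
  rw [abs_of_nonneg (Real.log_nonneg (Real.one_le_cosh x))]
  rw [Real.log_le_iff_le_exp (Real.cosh_pos x), ← Real.cosh_abs, Real.cosh_eq]
  have : Real.exp (-|x|) ≤ Real.exp |x| := Real.exp_le_exp.2 (by linarith [abs_nonneg x])
  linarith

lemma aux_deriv (t : ℝ) (ht : 0 < t) :
    HasDerivAt (fun t => ∫ z, Real.log (Real.cosh (t + √t * z)) ∂(gaussianReal 0 1))
      (∫ z, Real.tanh (t + √t * z) * (1 + z / (2 * √t)) ∂(gaussianReal 0 1)) t := by
  have hc : ∀ t : ℝ, Continuous fun z : ℝ => Real.log (Real.cosh (t + √t * z)) := fun t =>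
    (Real.continuous_cosh.comp (by fun_prop)).log fun z => (Real.cosh_pos _).ne'
  refine (hasDerivAt_integral_of_dominated_loc_of_deriv_le (s := Set.Ioi (t/2))
    (bound := fun z => 1 + |z| / (2 * √(t/2)))
    (F' := fun t z => Real.tanh (t + √t * z) * (1 + z / (2 * √t)))
    (Ioi_mem_nhds (by linarith)) ?_ ?_ ?_ ?_ ?_ ?_).2
  · exact Filter.Eventually.of_forall fun t => (hc t).aestronglyMeasurable
  · refine Integrable.mono' (g := fun z => |t + √t * z|) ?_ (hc t).aestronglyMeasurable ?_
    · exact ((integrable_const _).add (aux_intz.const_mul _)).abs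
    · exact Filter.Eventually.of_forall fun z => aux_logcosh _
  · exact ((aux_tanh_cont.comp (by fun_prop)).mul (by fun_prop)).aestronglyMeasurable
  · refine Filter.Eventually.of_forall fun z x hx => ?_
    have hx' : t/2 < x := hx
    have h2 : 0 < √(t/2) := Real.sqrt_pos.2 (by linarith)
    have h3 : √(t/2) ≤ √x := Real.sqrt_le_sqrt hx'.le
    have h4 : 0 < √x := by linarith
    rw [norm_mul]
    calc _ ≤ 1 * ‖1 + z / (2 * √x)‖ := by
            gcongr
            exact (Real.abs_tanh_lt_one _).le
      _ ≤ 1 + |z| / (2 * √x) := by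
            rw [one_mul]
            refine (norm_add_le _ _).trans ?_
            rw [norm_div, Real.norm_of_nonneg (by positivity : 0 ≤ 2 * √x)]
            simp
      _ ≤ _ := by gcongr
  · exact (integrable_const _).add (aux_intz.abs.div_const _)
  · refine Filter.Eventually.of_forall fun z x hx => ?_
    have hx' : t/2 < x := hx
    have hx0 : x ≠ 0 := by linarith
    have h1 : HasDerivAt (fun x => x + √x * z) (1 + 1 / (2 * √x) * z) x :=
      (hasDerivAt_id x).add ((Real.hasDerivAt_sqrt hx0).mul_const z)
    have h2 := (h1.cosh).log (Real.cosh_pos _).ne'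
    convert! h2 using 1
    rw [Real.tanh_eq_sinh_div_cosh]
    ring

lemma aux_val (t : ℝ) (ht : 0 < t) :
    1/2 < ∫ z, Real.tanh (t + √t * z) * (1 + z / (2 * √t)) ∂(gaussianReal 0 1) := by
  obtain ⟨s, hs, rfl⟩ : ∃ s : ℝ, 0 < s ∧ t = s^2 := ⟨√t, Real.sqrt_pos.2 ht, (Real.sq_sqrt ht.le).symm⟩
  rw [Real.sqrt_sq hs.le]
  have e : ∀ z, Real.tanh (s^2 + s * z) * (1 + z / (2 * s)) = 
     (1/2) * Real.tanh (s^2+s*z) + (1/(2*s^2)) * ((s^2+s*z) * Real.tanh (s^2+s*z)) := fun z => by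
    field_simp
    ring
  simp_rw [e]
  have i1 : Integrable (fun z => Real.tanh (s^2 + s*z)) (gaussianReal 0 1) := by
    simpa using aux_int_mul (fun _ => 1) (integrable_const _) s
  rw [integral_add (i1.const_mul _) ((aux_int_mul _ (aux_intX s) s).const_mul _),
    integral_const_mul, integral_const_mul, aux_X]
  have := aux_T s hs
  have h2 : 1/(2*s^2) * s^2 = 1/2 := by field_simp
  linarith

/-- for the linear model (λ = 1) and any `R > 0`, `σ > 0`, the modified
free energy `m ↦ L_m(σ)` is differentiable from the right at `m = 0` and its right
derivative there is strictly negative. -/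
theorem linear_model_right_deriv_neg (R σ : ℝ) (hR : 0 < R) (hσ : 0 < σ) :
    ∃ d : ℝ, d < 0 ∧
      HasDerivWithinAt (fun m => modFreeEnergyLin R σ m) d (Set.Ici (0 : ℝ)) 0 := by
  set a : ℝ := σ^2 + 1 with ha
  have ha0 : 0 < a := by positivity
  have hσ2 : σ^2 ≠ 0 := by positivity
  set t : ℝ := (R * a)⁻¹ with htdef
  have ht : 0 < t := by positivity
  set D := ∫ z, Real.tanh (t + √t * z) * (1 + z / (2 * √t)) ∂(gaussianReal 0 1) with hD
  have hval : 1/2 < D := aux_val t ht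
  have hfun : (fun m => modFreeEnergyLin R σ m) = fun m =>
      (1 / 2) * Real.log (1 + (1 - m) / σ ^ 2) + (1 + m) * R / (2 * (R * (a - m)))
      - R * (fun t => ∫ z, Real.log (Real.cosh (t + √t * z)) ∂(gaussianReal 0 1))
        ((R * (a - m))⁻¹) := by
    ext m
    simp only [modFreeEnergyLin, ← ha]
    congr 2
    refine integral_congr_ae (Filter.Eventually.of_forall fun z => ?_)
    simp only
    rw [Real.sqrt_inv, ← Real.sqrt_div_self]
    congr 2
    ring
  have hq : HasDerivAt (fun m : ℝ => R * (a - m)) (R * (-1)) 0 :=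
    ((hasDerivAt_id (0:ℝ)).const_sub a).const_mul R
  have hR0 : R * (a - 0) ≠ 0 := by rw [sub_zero]; positivity
  have h1 : HasDerivAt (fun m : ℝ => (1 / 2) * Real.log (1 + (1 - m) / σ ^ 2))
      ((1/2) * ((-1 / σ^2) / (1 + (1 - 0) / σ^2))) 0 :=
    (((((hasDerivAt_id (0:ℝ)).const_sub 1).div_const (σ^2)).const_add 1).log
      (by simp only [id]; rw [sub_zero]; positivity)).const_mul (1/2)
  have h2 : HasDerivAt (fun m : ℝ => (1 + m) * R / (2 * (R * (a - m))))
      ((1 * R * (2 * (R * (a - 0))) - (1 + 0) * R * (2 * (R * (-1)))) / (2 * (R * (a - 0)))^2) 0 :=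
    (((hasDerivAt_id (0:ℝ)).const_add 1).mul_const R).div (hq.const_mul 2)
      (mul_ne_zero two_ne_zero hR0)
  have h3 := hq.inv hR0
  have h4 : HasDerivAt (fun t => ∫ z, Real.log (Real.cosh (t + √t * z)) ∂(gaussianReal 0 1))
      D ((R * (a - 0))⁻¹) := by
    rw [sub_zero]; exact aux_deriv t ht
  have h5 := ((h1.add h2).sub ((h4.comp (0:ℝ) h3).const_mul R))
  refine ⟨(1/2 - D) / a^2, div_neg_of_neg_of_pos (by linarith) (by positivity), ?_⟩
  rw [hfun]
  refine HasDerivAt.hasDerivWithinAt ?_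
  convert! h5 using 1
  have e : (1 + (1 - 0) / σ^2) = a / σ^2 := by rw [ha]; field_simp; ring
  rw [e]
  simp only [sub_zero]
  field_simp
  ring
end

section
/- (Lemma 2: independent inference via the quadratic field.) Let λ = 2, fix σ > 0, and define the threshold load R_Th = 2/(σ² + 1). If R > R_Th, then m = 0 is a strict local minimizer of the extended modified free energy on [0,1]: there exists ε > 0 such that L_m(σ) > L_0(σ) for all m ∈ (0, ε). If R < R_Th, then m = 0 is a strict local maximizer: there exists ε > 0 such that L_m(σ) < L_0(σ) for all m ∈ (0, ε). -/
open MeasureTheory ProbabilityTheory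

/-- The replica-symmetric modified free energy of the purely quadratic model (λ = 2):
for `m ∈ (0,1]`, `ξ_m = (1−m²)/σ²`, `ρ_m² = Rσ²(1+ξ_m)/(2m)` and
`L_m(σ) = (1/2)log(1+ξ_m) + (1+m)R/(2ρ_m²) − R·E[log cosh((1+ρ_m Z)/ρ_m²)]`;
at `m = 0` it is extended by `L_0(σ) = (1/2)log(1 + 1/σ²)`. -/
noncomputable def modFreeEnergyQuad (R σ m : ℝ) : ℝ :=
  if m = 0 then (1 / 2) * Real.log (1 + 1 / σ ^ 2)
  else
    (1 / 2) * Real.log (1 + (1 - m ^ 2) / σ ^ 2)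
      + (1 + m) * R / (2 * (R * σ ^ 2 * (1 + (1 - m ^ 2) / σ ^ 2) / (2 * m)))
      - R * ∫ z, Real.log (Real.cosh
          ((1 + Real.sqrt (R * σ ^ 2 * (1 + (1 - m ^ 2) / σ ^ 2) / (2 * m)) * z)
            / (R * σ ^ 2 * (1 + (1 - m ^ 2) / σ ^ 2) / (2 * m)))) ∂(gaussianReal 0 1)

lemma qm_nonneg (f f' : ℝ → ℝ) (h0 : f 0 = 0) (hd : ∀ x, HasDerivAt f (f' x) x)
    (hp : ∀ x, 0 ≤ x → 0 ≤ f' x) (x : ℝ) (hx : 0 ≤ x) : 0 ≤ f x := by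
  have hm : MonotoneOn f (Set.Ici 0) := by
    apply monotoneOn_of_deriv_nonneg (convex_Ici 0)
    · exact fun y _ => (hd y).continuousAt.continuousWithinAt
    · exact fun y _ => (hd y).differentiableAt.differentiableWithinAt
    · intro y hy
      rw [(hd y).deriv]
      exact hp y (interior_subset hy)
  have := hm (Set.mem_Ici.2 le_rfl) (Set.mem_Ici.2 hx) hx
  rwa [h0] at this

lemma qm_tanh_deriv (x : ℝ) : HasDerivAt (fun y => Real.sinh y / Real.cosh y)
    (1 - (Real.sinh x / Real.cosh x) ^ 2) x := by
  have h := (Real.hasDerivAt_sinh x).div (Real.hasDerivAt_cosh x) (Real.cosh_pos x).ne'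
  refine h.congr_deriv ?_
  have := (Real.cosh_pos x).ne'
  field_simp

lemma qm_tanh_nonneg (x : ℝ) (hx : 0 ≤ x) : 0 ≤ Real.sinh x / Real.cosh x :=
  div_nonneg (Real.sinh_nonneg_iff.2 hx) (Real.cosh_pos x).le

lemma qm_tanh_le (x : ℝ) (hx : 0 ≤ x) : Real.sinh x / Real.cosh x ≤ x := by
  have := qm_nonneg (fun y => y - Real.sinh y / Real.cosh y)
    (fun y => 1 - (1 - (Real.sinh y / Real.cosh y) ^ 2)) (by simp)
    (fun y => (hasDerivAt_id y).sub (qm_tanh_deriv y))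
    (fun y _ => by nlinarith [sq_nonneg (Real.sinh y / Real.cosh y)]) x hx
  simpa using this

lemma qm_tanh_ge (x : ℝ) (hx : 0 ≤ x) : x - x ^ 3 / 3 ≤ Real.sinh x / Real.cosh x := by
  have := qm_nonneg (fun y => Real.sinh y / Real.cosh y - (y - y ^ 3 / 3))
    (fun y => (1 - (Real.sinh y / Real.cosh y) ^ 2) - (1 - (3 : ℕ) * y ^ 2 / 3)) (by simp)
    (fun y => (qm_tanh_deriv y).sub ((hasDerivAt_id y).sub ((hasDerivAt_pow 3 y).div_const 3)))
    (fun y hy => by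
      have h1 := qm_tanh_le y hy
      have h2 := qm_tanh_nonneg y hy
      push_cast
      nlinarith) x hx
  simpa using this

lemma qm_tanh_le' (x : ℝ) (hx : 0 ≤ x) :
    Real.sinh x / Real.cosh x ≤ x - x ^ 3 / 3 + 2 * (x ^ 5 / 15) := by
  have := qm_nonneg (fun y => (y - y ^ 3 / 3 + 2 * (y ^ 5 / 15)) - Real.sinh y / Real.cosh y)
    (fun y => (1 - (3 : ℕ) * y ^ 2 / 3 + 2 * ((5 : ℕ) * y ^ 4 / 15))
      - (1 - (Real.sinh y / Real.cosh y) ^ 2)) (by simp)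
    (fun y => ((((hasDerivAt_id y).sub ((hasDerivAt_pow 3 y).div_const 3)).add
      (((hasDerivAt_pow 5 y).div_const 15).const_mul 2)).sub (qm_tanh_deriv y)))
    (fun y hy => by
      have h1 := qm_tanh_ge y hy
      have h2 := qm_tanh_nonneg y hy
      push_cast
      rcases le_total (y ^ 2) 3 with h | h
      · have h3 : 0 ≤ y - y ^ 3 / 3 := by nlinarith
        have h4 := pow_le_pow_left₀ h3 h1 2
        nlinarith [sq_nonneg (y ^ 3)]
      · nlinarith [sq_nonneg (Real.sinh y / Real.cosh y)]) x hx
  simpa using this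

lemma qm_logcosh_deriv (x : ℝ) : HasDerivAt (fun y => Real.log (Real.cosh y))
    (Real.sinh x / Real.cosh x) x := (Real.hasDerivAt_cosh x).log (Real.cosh_pos x).ne'

lemma qm_logcosh_ge (x : ℝ) : x ^ 2 / 2 - x ^ 4 / 12 ≤ Real.log (Real.cosh x) := by
  have key : ∀ x : ℝ, 0 ≤ x → x ^ 2 / 2 - x ^ 4 / 12 ≤ Real.log (Real.cosh x) := by
    intro x hx
    have := qm_nonneg (fun y => Real.log (Real.cosh y) - (y ^ 2 / 2 - y ^ 4 / 12))
      (fun y => Real.sinh y / Real.cosh y - ((2 : ℕ) * y ^ 1 / 2 - (4 : ℕ) * y ^ 3 / 12)) (by simp)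
      (fun y => (qm_logcosh_deriv y).sub
        (((hasDerivAt_pow 2 y).div_const 2).sub ((hasDerivAt_pow 4 y).div_const 12)))
      (fun y hy => by
        have h1 := qm_tanh_ge y hy
        push_cast
        linarith) x hx
    simpa using this
  have h := key |x| (abs_nonneg x)
  rwa [Real.cosh_abs, sq_abs, Even.pow_abs (by decide)] at h

lemma qm_logcosh_le (x : ℝ) :
    Real.log (Real.cosh x) ≤ x ^ 2 / 2 - x ^ 4 / 12 + x ^ 6 / 45 := by
  have key : ∀ x : ℝ, 0 ≤ x → Real.log (Real.cosh x) ≤ x ^ 2 / 2 - x ^ 4 / 12 + x ^ 6 / 45 := by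
    intro x hx
    have := qm_nonneg (fun y => (y ^ 2 / 2 - y ^ 4 / 12 + y ^ 6 / 45) - Real.log (Real.cosh y))
      (fun y => ((2 : ℕ) * y ^ 1 / 2 - (4 : ℕ) * y ^ 3 / 12 + (6 : ℕ) * y ^ 5 / 45)
        - Real.sinh y / Real.cosh y) (by simp)
      (fun y => ((((hasDerivAt_pow 2 y).div_const 2).sub ((hasDerivAt_pow 4 y).div_const 12)).add
        ((hasDerivAt_pow 6 y).div_const 45)).sub (qm_logcosh_deriv y))
      (fun y hy => by
        have h1 := qm_tanh_le' y hy
        push_cast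
        linarith) x hx
    simpa using this
  have h := key |x| (abs_nonneg x)
  rwa [Real.cosh_abs, sq_abs, Even.pow_abs (by decide), Even.pow_abs (by decide)] at h

lemma qm_step (n : ℕ) (f p p' : ℝ → ℝ)
    (h : iteratedDeriv n f = fun t => p t * Real.exp (t ^ 2 / 2))
    (hp : ∀ t, HasDerivAt p (p' t) t) :
    iteratedDeriv (n + 1) f = fun t => (p' t + t * p t) * Real.exp (t ^ 2 / 2) := by
  rw [iteratedDeriv_succ, h]
  funext t
  have h1 : HasDerivAt (fun t : ℝ => Real.exp (t ^ 2 / 2)) (Real.exp (t ^ 2 / 2) * t) t := by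
    refine (((hasDerivAt_pow 2 t).div_const 2).exp).congr_deriv ?_
    push_cast
    ring
  refine (((hp t).mul h1).congr_deriv ?_).deriv
  ring

lemma qm_moments :
    (∫ z, z ^ 1 ∂(gaussianReal 0 1) = 0) ∧ (∫ z, z ^ 2 ∂(gaussianReal 0 1) = 1) ∧
    (∫ z, z ^ 3 ∂(gaussianReal 0 1) = 0) ∧ (∫ z, z ^ 4 ∂(gaussianReal 0 1) = 3) ∧
    (∫ z, z ^ 5 ∂(gaussianReal 0 1) = 0) ∧ (∫ z, z ^ 6 ∂(gaussianReal 0 1) = 15) := by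
  have hm : ∀ n : ℕ, ∫ z, z ^ n ∂(gaussianReal 0 1)
      = iteratedDeriv n (mgf id (gaussianReal 0 1)) 0 := by
    intro n
    rw [iteratedDeriv_mgf_zero (by simp)]
    simp
  have h0 : iteratedDeriv 0 (mgf id (gaussianReal 0 1))
      = fun t => (fun _ => (1 : ℝ)) t * Real.exp (t ^ 2 / 2) := by
    rw [iteratedDeriv_zero, mgf_id_gaussianReal]
    funext t
    simp
  have h1 := qm_step 0 _ _ (fun _ => 0) h0 (fun t => hasDerivAt_const t 1)
  have h2 := qm_step 1 _ (fun t => 0 + t * 1) (fun _ => 1) h1 (fun t => by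
    simpa using hasDerivAt_id' t)
  have h3 := qm_step 2 _ (fun t => 1 + t ^ 2) (fun t => 2 * t)
    (by rw [h2]; funext t; ring) (fun t =>
      ((hasDerivAt_pow 2 t).const_add 1).congr_deriv (by simp))
  have h4 := qm_step 3 _ (fun t => 3 * t + t ^ 3) (fun t => 3 + 3 * t ^ 2)
    (by rw [h3]; funext t; ring) (fun t =>
      (((hasDerivAt_id t).const_mul 3).add (hasDerivAt_pow 3 t)).congr_deriv (by simp))
  have h5 := qm_step 4 _ (fun t => 3 + 6 * t ^ 2 + t ^ 4) (fun t => 6 * (2 * t) + 4 * t ^ 3)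
    (by rw [h4]; funext t; ring) (fun t =>
      ((((hasDerivAt_pow 2 t).const_mul 6).const_add 3).add (hasDerivAt_pow 4 t)).congr_deriv (by simp))
  have h6 := qm_step 5 _ (fun t => 15 * t + 10 * t ^ 3 + t ^ 5)
    (fun t => 15 + 10 * (3 * t ^ 2) + 5 * t ^ 4)
    (by rw [h5]; funext t; ring) (fun t =>
      ((((hasDerivAt_id t).const_mul 15).add ((hasDerivAt_pow 3 t).const_mul 10)).add
        (hasDerivAt_pow 5 t)).congr_deriv (by simp))
  refine ⟨?_, ?_, ?_, ?_, ?_, ?_⟩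
  · rw [hm, h1]; simp
  · rw [hm, h2]; simp
  · rw [hm, h3]; simp
  · rw [hm, h4]; simp
  · rw [hm, h5]; simp
  · rw [hm, h6]; simp

lemma qm_int_pow (n : ℕ) : Integrable (fun z : ℝ => z ^ n) (gaussianReal 0 1) := by
  have h := (memLp_id_gaussianReal (μ := 0) (v := 1) (n : NNReal)).integrable_norm_pow'
  exact (integrable_norm_iff (by fun_prop)).1 (by simpa using h)

/-- Bochner integral of a degree-six polynomial against the standard Gaussian. -/
lemma qm_poly (a0 a1 a2 a3 a4 a5 a6 : ℝ) :
    Integrable (fun z : ℝ => a0 + a1 * z ^ 1 + a2 * z ^ 2 + a3 * z ^ 3 + a4 * z ^ 4 + a5 * z ^ 5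
      + a6 * z ^ 6) (gaussianReal 0 1) ∧
    ∫ z, (a0 + a1 * z ^ 1 + a2 * z ^ 2 + a3 * z ^ 3 + a4 * z ^ 4 + a5 * z ^ 5
      + a6 * z ^ 6) ∂(gaussianReal 0 1) = a0 + a2 + 3 * a4 + 15 * a6 := by
  obtain ⟨m1, m2, m3, m4, m5, m6⟩ := qm_moments
  have i0 : Integrable (fun _ : ℝ => a0) (gaussianReal 0 1) := integrable_const _
  have i1 := i0.add ((qm_int_pow 1).const_mul a1)
  have i2 := i1.add ((qm_int_pow 2).const_mul a2)
  have i3 := i2.add ((qm_int_pow 3).const_mul a3)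
  have i4 := i3.add ((qm_int_pow 4).const_mul a4)
  have i5 := i4.add ((qm_int_pow 5).const_mul a5)
  have i6 := i5.add ((qm_int_pow 6).const_mul a6)
  refine ⟨i6, ?_⟩
  have e6 := integral_add i5 ((qm_int_pow 6).const_mul a6)
  have e5 := integral_add i4 ((qm_int_pow 5).const_mul a5)
  have e4 := integral_add i3 ((qm_int_pow 4).const_mul a4)
  have e3 := integral_add i2 ((qm_int_pow 3).const_mul a3)
  have e2 := integral_add i1 ((qm_int_pow 2).const_mul a2)
  have e1 := integral_add i0 ((qm_int_pow 1).const_mul a1)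
  simp only [Pi.add_apply, integral_const_mul, m1, m2, m3, m4, m5, m6] at e1 e2 e3 e4 e5 e6
  rw [e6, e5, e4, e3, e2, e1]
  simp
  ring

lemma qm_G (s : ℝ) (hs : s ^ 2 ≤ 1) :
    |∫ z, Real.log (Real.cosh (s ^ 2 + s * z)) ∂(gaussianReal 0 1) - (s ^ 2 / 2 + s ^ 4 / 4)|
      ≤ 2 * s ^ 6 := by
  obtain ⟨il, el⟩ := qm_poly (s ^ 4 / 2 - s ^ 8 / 12) (s ^ 3 - 4 * s ^ 7 / 12)
    (s ^ 2 / 2 - 6 * s ^ 6 / 12) (- 4 * s ^ 5 / 12) (- s ^ 4 / 12) 0 0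
  obtain ⟨iu, eu⟩ := qm_poly (s ^ 4 / 2 - s ^ 8 / 12 + s ^ 12 / 45)
    (s ^ 3 - 4 * s ^ 7 / 12 + 6 * s ^ 11 / 45)
    (s ^ 2 / 2 - 6 * s ^ 6 / 12 + 15 * s ^ 10 / 45) (- 4 * s ^ 5 / 12 + 20 * s ^ 9 / 45)
    (- s ^ 4 / 12 + 15 * s ^ 8 / 45) (6 * s ^ 7 / 45) (s ^ 6 / 45)
  have hl := fun z : ℝ => qm_logcosh_ge (s ^ 2 + s * z)
  have hu := fun z : ℝ => qm_logcosh_le (s ^ 2 + s * z)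
  have hi : Integrable (fun z => Real.log (Real.cosh (s ^ 2 + s * z))) (gaussianReal 0 1) := by
    refine integrable_of_le_of_le ?_ (Filter.Eventually.of_forall fun z => ?_)
      (Filter.Eventually.of_forall fun z => ?_) il iu
    · apply Measurable.aestronglyMeasurable
      have : Measurable Real.cosh := Real.continuous_cosh.measurable
      fun_prop
    · refine le_of_eq_of_le ?_ (hl z)
      ring
    · refine le_of_le_of_eq (hu z) ?_
      ring
  have Il := integral_mono il hi (fun z => le_of_eq_of_le (by ring) (hl z))
  have Iu := integral_mono hi iu (fun z => le_of_le_of_eq (hu z) (by ring))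
  rw [el] at Il
  rw [eu] at Iu
  have p1 : s ^ 8 ≤ s ^ 6 := by nlinarith [pow_nonneg (sq_nonneg s) 3]
  have p2 : s ^ 10 ≤ s ^ 8 := by nlinarith [pow_nonneg (sq_nonneg s) 4]
  have p3 : s ^ 12 ≤ s ^ 10 := by nlinarith [pow_nonneg (sq_nonneg s) 5]
  have q1 : 0 ≤ s ^ 8 := by positivity
  have q2 : 0 ≤ s ^ 6 := by positivity
  rw [abs_le]
  constructor <;> linarith

/-- Two-sided bound on the increment of the free energy. -/
lemma qm_bounds (R σ m : ℝ) (hR : 0 < R) (hσ : 0 < σ) (hm : 0 < m) (hma : m ^ 2 < σ ^ 2 + 1)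
    (ht : 2 * m ≤ R * (σ ^ 2 + 1 - m ^ 2)) :
    m ^ 2 * (1 / (2 * (σ ^ 2 + 1 - m ^ 2)) - 1 / (R * (σ ^ 2 + 1 - m ^ 2) ^ 2)
        - 16 * m / (R ^ 2 * (σ ^ 2 + 1 - m ^ 2) ^ 3))
      ≤ modFreeEnergyQuad R σ m - modFreeEnergyQuad R σ 0 ∧
    modFreeEnergyQuad R σ m - modFreeEnergyQuad R σ 0 ≤
      m ^ 2 * (1 / (σ ^ 2 + 1 - m ^ 2) - 1 / (2 * (σ ^ 2 + 1))
        - 1 / (R * (σ ^ 2 + 1 - m ^ 2) ^ 2)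
        + 16 * m / (R ^ 2 * (σ ^ 2 + 1 - m ^ 2) ^ 3)) := by
  have hb : 0 < σ ^ 2 + 1 - m ^ 2 := by linarith
  set b := σ ^ 2 + 1 - m ^ 2 with hbdef
  have ha : 0 < σ ^ 2 + 1 := by positivity
  have e1 : 1 + (1 - m ^ 2) / σ ^ 2 = b / σ ^ 2 := by
    rw [hbdef]; field_simp; ring
  have e2 : R * σ ^ 2 * (1 + (1 - m ^ 2) / σ ^ 2) / (2 * m) = R * b / (2 * m) := by
    rw [e1]; field_simp
  have e3 : 1 + 1 / σ ^ 2 = (σ ^ 2 + 1) / σ ^ 2 := by field_simp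
  set ρ := Real.sqrt (R * b / (2 * m)) with hρ
  have hρ2 : ρ ^ 2 = R * b / (2 * m) := Real.sq_sqrt (by positivity)
  have hρ0 : 0 < ρ := Real.sqrt_pos.2 (by positivity)
  have hs2 : (1 / ρ) ^ 2 = 2 * m / (R * b) := by
    rw [div_pow, hρ2]; field_simp
  have hG := qm_G (1 / ρ) (by rw [hs2, div_le_one (by positivity)]; exact ht)
  have e4 : ∀ z : ℝ, (1 + ρ * z) / (R * b / (2 * m)) = (1 / ρ) ^ 2 + 1 / ρ * z := by
    intro z; rw [← hρ2]; field_simp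
  have e5 : (1 / ρ) ^ 4 = (2 * m / (R * b)) ^ 2 := by rw [← hs2]; ring
  have e6 : (1 / ρ) ^ 6 = (2 * m / (R * b)) ^ 3 := by rw [← hs2]; ring
  have hD : modFreeEnergyQuad R σ m - modFreeEnergyQuad R σ 0
      = (1 / 2) * Real.log (b / (σ ^ 2 + 1)) + (1 + m) * R / (2 * (R * b / (2 * m)))
        - R * ∫ z, Real.log (Real.cosh ((1 / ρ) ^ 2 + 1 / ρ * z)) ∂(gaussianReal 0 1) := by
    unfold modFreeEnergyQuad
    rw [if_neg hm.ne', if_pos rfl, e2, e1, e3]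
    simp only [← hρ, e4]
    rw [Real.log_div hb.ne' (by positivity), Real.log_div ha.ne' (by positivity),
      Real.log_div hb.ne' ha.ne']
    ring
  rw [hD]
  generalize (∫ z, Real.log (Real.cosh ((1 / ρ) ^ 2 + 1 / ρ * z)) ∂(gaussianReal 0 1)) = I at hG
  rw [hs2, e5, e6, abs_le] at hG
  have l1 := Real.one_sub_inv_le_log_of_pos (div_pos hb ha)
  have l2 := Real.log_le_sub_one_of_pos (div_pos hb ha)
  have l1' : - (m ^ 2 / b) ≤ Real.log (b / (σ ^ 2 + 1)) := by
    refine le_of_eq_of_le ?_ l1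
    have : σ ^ 2 + 1 = b + m ^ 2 := by rw [hbdef]; ring
    rw [this]; field_simp; ring
  have l2' : Real.log (b / (σ ^ 2 + 1)) ≤ - (m ^ 2 / (σ ^ 2 + 1)) := by
    refine le_of_le_of_eq l2 ?_
    rw [hbdef]; field_simp; ring
  have g1 := mul_le_mul_of_nonneg_left hG.1 hR.le
  have g2 := mul_le_mul_of_nonneg_left hG.2 hR.le
  have f1 : R * (2 * (2 * m / (R * b)) ^ 3) = m ^ 2 * (16 * m / (R ^ 2 * b ^ 3)) := by
    field_simp; ring
  have f2 : R * (2 * m / (R * b) / 2 + (2 * m / (R * b)) ^ 2 / 4)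
      = m / b + m ^ 2 * (1 / (R * b ^ 2)) := by
    field_simp; ring
  have f3 : (1 + m) * R / (2 * (R * b / (2 * m))) = m / b + m ^ 2 / b := by
    field_simp
  have f4 : m ^ 2 * (1 / (2 * b)) = m ^ 2 / b / 2 := by field_simp
  have f5 : m ^ 2 * (1 / b) = m ^ 2 / b := by field_simp
  have f6 : m ^ 2 * (1 / (2 * (σ ^ 2 + 1))) = m ^ 2 / (σ ^ 2 + 1) / 2 := by field_simp
  rw [mul_neg, f1, mul_sub, f2] at g1
  rw [f1, mul_sub, f2] at g2
  rw [f3]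
  constructor
  · rw [mul_sub, mul_sub, f4]; linarith
  · rw [mul_add, mul_sub, mul_sub, f5, f6]; linarith

/-- Lemma 2: independent inference via the quadratic field: with the
threshold load `R_Th = 2/(σ²+1)`, if `R > R_Th` then `m = 0` is a strict local minimizer
of the extended modified free energy on `[0,1]`, and if `R < R_Th` it is a strict local
maximizer. -/
theorem quadratic_model_threshold (R σ : ℝ) (hR : 0 < R) (hσ : 0 < σ) :
    (2 / (σ ^ 2 + 1) < R → ∃ ε > 0, ∀ m : ℝ, 0 < m → m < ε →
        modFreeEnergyQuad R σ 0 < modFreeEnergyQuad R σ m) ∧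
    (R < 2 / (σ ^ 2 + 1) → ∃ ε > 0, ∀ m : ℝ, 0 < m → m < ε →
        modFreeEnergyQuad R σ m < modFreeEnergyQuad R σ 0) := by
  have ha : 0 < σ ^ 2 + 1 := by positivity
  have hc : ContinuousAt (fun m : ℝ => σ ^ 2 + 1 - m ^ 2) 0 := by fun_prop
  have E1 : ∀ᶠ m : ℝ in nhds 0, 0 < σ ^ 2 + 1 - m ^ 2 :=
    hc.eventually (lt_mem_nhds (by simpa using ha))
  have hc2 : ContinuousAt (fun m : ℝ => R * (σ ^ 2 + 1 - m ^ 2) - 2 * m) 0 := by fun_prop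
  have E2 : ∀ᶠ m : ℝ in nhds 0, 0 < R * (σ ^ 2 + 1 - m ^ 2) - 2 * m :=
    hc2.eventually (lt_mem_nhds (by simpa using mul_pos hR ha))
  constructor
  · intro h
    have hl : ContinuousAt (fun m : ℝ => 1 / (2 * (σ ^ 2 + 1 - m ^ 2))
        - 1 / (R * (σ ^ 2 + 1 - m ^ 2) ^ 2) - 16 * m / (R ^ 2 * (σ ^ 2 + 1 - m ^ 2) ^ 3)) 0 := by
      fun_prop (disch := (simp only [ne_eq, OfNat.ofNat_ne_zero, not_false_eq_true, zero_pow, sub_zero]; positivity))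
    have E3 := hl.eventually (lt_mem_nhds (a := 0) (by
      rw [div_lt_iff₀ ha] at h
      have : 1 / (R * (σ ^ 2 + 1) ^ 2) < 1 / (2 * (σ ^ 2 + 1)) := by
        apply one_div_lt_one_div_of_lt (by positivity)
        nlinarith
      norm_num at this ⊢
      linarith))
    obtain ⟨ε, hε, H⟩ := Metric.eventually_nhds_iff.1 (E1.and (E2.and E3))
    refine ⟨ε, hε, fun m hm hme => ?_⟩
    obtain ⟨h1, h2, h3⟩ := H (y := m) (by simpa [abs_of_pos hm] using hme)
    have hb := (qm_bounds R σ m hR hσ hm (by linarith) (by linarith)).1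
    have := mul_pos (pow_pos hm 2) h3
    linarith
  · intro h
    have hl : ContinuousAt (fun m : ℝ => 1 / (σ ^ 2 + 1 - m ^ 2) - 1 / (2 * (σ ^ 2 + 1))
        - 1 / (R * (σ ^ 2 + 1 - m ^ 2) ^ 2) + 16 * m / (R ^ 2 * (σ ^ 2 + 1 - m ^ 2) ^ 3)) 0 := by
      fun_prop (disch := (simp only [ne_eq, OfNat.ofNat_ne_zero, not_false_eq_true, zero_pow, sub_zero]; positivity))
    have E3 := hl.eventually_lt (continuousAt_const (y := (0 : ℝ))) (by
      rw [lt_div_iff₀ ha] at h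
      have : 1 / (2 * (σ ^ 2 + 1)) < 1 / (R * (σ ^ 2 + 1) ^ 2) := by
        apply one_div_lt_one_div_of_lt (by positivity)
        nlinarith
      have h' : 1 / (σ ^ 2 + 1) = 2 * (1 / (2 * (σ ^ 2 + 1))) := by field_simp
      simp only [ne_eq, OfNat.ofNat_ne_zero, not_false_eq_true, zero_pow, sub_zero, mul_zero,
        zero_div, add_zero]
      linarith)
    obtain ⟨ε, hε, H⟩ := Metric.eventually_nhds_iff.1 (E1.and (E2.and E3))
    refine ⟨ε, hε, fun m hm hme => ?_⟩
    obtain ⟨h1, h2, h3⟩ := H (y := m) (by simpa [abs_of_pos hm] using hme)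
    have hb := (qm_bounds R σ m hR hσ hm (by linarith) (by linarith)).2
    have := mul_neg_of_pos_of_neg (pow_pos hm 2) h3
    linarith
end

section
/- There exists a unique σ_C² > 0 such that: for all t ∈ (0, σ_C²), 2/(t + 1) < log(1 + 1/t)/(2·log 2), and for all t > σ_C², 2/(t + 1) > log(1 + 1/t)/(2·log 2). Equivalently, the function t ↦ (t + 1)·log(1 + 1/t) is strictly decreasing on (0, ∞) and crosses the value 4·log 2 exactly once. Consequently, for the purely quadratic model the threshold load R_Th = 2/(σ² + 1) is smaller than the critical load R* = C(σ)/log 2 exactly when the noise variance σ² is below the critical value σ_C². -/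
theorem crit_hasDeriv (t : ℝ) (ht : 0 < t) :
    HasDerivAt (fun t : ℝ => (t + 1) * Real.log (1 + 1 / t))
      (Real.log (1 + 1 / t) - 1 / t) t := by
  have h1 : HasDerivAt (fun t : ℝ => 1 + 1 / t) (-(t ^ 2)⁻¹) t := by
    simpa [one_div] using (hasDerivAt_inv ht.ne').const_add 1
  have hp : (1 + 1 / t) ≠ 0 := by positivity
  have h2 := ((hasDerivAt_id t).add_const 1).mul (h1.log hp)
  refine h2.congr_deriv ?_
  have : t + 1 ≠ 0 := by positivity
  simp only [id]
  field_simp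
  ring

theorem crit_anti :
    StrictAntiOn (fun t : ℝ => (t + 1) * Real.log (1 + 1 / t)) (Set.Ioi 0) := by
  refine strictAntiOn_of_deriv_neg (convex_Ioi 0) ?_ ?_
  · intro t ht
    exact (crit_hasDeriv t ht).continuousAt.continuousWithinAt
  · intro t ht
    rw [interior_Ioi] at ht
    have ht : 0 < t := ht
    rw [(crit_hasDeriv t ht).deriv]
    have h0 : 0 < 1 / t := by positivity
    have := Real.log_lt_sub_one_of_pos (x := 1 + 1 / t) (by positivity) (by linarith)
    linarith

theorem crit_exists : ∃ c : ℝ, 0 < c ∧ (c + 1) * Real.log (1 + 1 / c) = 4 * Real.log 2 := by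
  have hl : 0 < Real.log 2 := Real.log_pos (by norm_num)
  have hc : ContinuousOn (fun t : ℝ => (t + 1) * Real.log (1 + 1 / t)) (Set.Icc (1 / 15) 1) := by
    intro t ht
    exact (crit_hasDeriv t (by linarith [ht.1])).continuousAt.continuousWithinAt
  have h16 : Real.log 16 = 4 * Real.log 2 := by
    rw [show (16 : ℝ) = 2 ^ 4 by norm_num, Real.log_pow]; norm_num
  have := intermediate_value_Icc' (by norm_num) hc
  obtain ⟨c, hc, h⟩ := this (show 4 * Real.log 2 ∈ _ by
    constructor
    · norm_num
      linarith
    · norm_num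
      linarith)
  exact ⟨c, by linarith [hc.1], h⟩

/-- there is a unique critical noise variance `σ_C² > 0` such that
`R_Th = 2/(t+1)` is below the Shannon load `C(t)/log 2 = log(1+1/t)/(2 log 2)` for
`t < σ_C²` and above it for `t > σ_C²`; equivalently, `t ↦ (t+1)·log(1+1/t)` is strictly
decreasing on `(0,∞)` and takes the value `4·log 2` exactly once. -/
theorem critical_noise_variance :
    (∃! c : ℝ, 0 < c ∧
      (∀ t : ℝ, 0 < t → t < c →
        2 / (t + 1) < Real.log (1 + 1 / t) / (2 * Real.log 2)) ∧
      (∀ t : ℝ, c < t →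
        2 / (t + 1) > Real.log (1 + 1 / t) / (2 * Real.log 2))) ∧
    StrictAntiOn (fun t : ℝ => (t + 1) * Real.log (1 + 1 / t)) (Set.Ioi 0) ∧
    (∃! c : ℝ, 0 < c ∧ (c + 1) * Real.log (1 + 1 / c) = 4 * Real.log 2) := by
  have hl : 0 < Real.log 2 := Real.log_pos (by norm_num)
  obtain ⟨c, hc, h⟩ := crit_exists
  refine ⟨⟨c, ⟨hc, ?_, ?_⟩, ?_⟩, crit_anti, ⟨c, ⟨hc, h⟩, ?_⟩⟩
  · intro t ht htc
    have := crit_anti (show t ∈ Set.Ioi 0 from ht) (show c ∈ Set.Ioi 0 from hc) htc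
    simp only at this
    rw [div_lt_div_iff₀ (by positivity) (by positivity)]
    linarith
  · intro t htc
    have ht : 0 < t := hc.trans htc
    have := crit_anti (show c ∈ Set.Ioi 0 from hc) (show t ∈ Set.Ioi 0 from ht) htc
    simp only at this
    rw [gt_iff_lt, div_lt_div_iff₀ (by positivity) (by positivity)]
    linarith
  · rintro d ⟨hd, h1, h2⟩
    rcases lt_trichotomy d c with hlt | heq | hgt
    · have := h2 c hlt
      rw [gt_iff_lt, div_lt_div_iff₀ (by positivity) (by positivity)] at this
      linarith
    · exact heq
    · have := h1 c hc hgt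
      rw [div_lt_div_iff₀ (by positivity) (by positivity)] at this
      linarith
  · rintro d ⟨hd, h1⟩
    exact crit_anti.injOn (show d ∈ Set.Ioi 0 from hd) (show c ∈ Set.Ioi 0 from hc) (h1.trans h.symm)
end
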